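/- Let X be a topological space equipped with an H-space structure: a continuous multiplication m : X × X → X and a point e ∈ X with m(e, e) = e, such that the maps x ↦ m(e, x) and x ↦ m(x, e) are each homotopic to the identity of X through homotopies fixing the point e. Suppose moreover that the composite of the diagonal with the multiplication, x ↦ m(x, x), is homotopic to the identity of X through a homotopy fixing e. Then for every n ≥ 1 the homotopy group πₙ(X, e) is trivial. -/

import Mathlib

open ContinuousMap

namespace GenLoop

variable {N X : Type*} [TopologicalSpace X] {e : X}

/-- Pointwise product of generalized loops with respect to a continuous multiplication `m`
such that `m (e, e) = e`. -/
def pointwiseMul (m : C(X × X, X)) (he : m (e, e) = e) (f g : GenLoop N X e) : GenLoop N X e :=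
  ⟨m.comp (f.1.prodMk g.1), fun y hy ↦ by
    change m (f.1 y, g.1 y) = e
    rw [f.2 y hy, g.2 y hy, he]⟩

theorem pointwiseMul_apply (m : C(X × X, X)) (he : m (e, e) = e) (f g : GenLoop N X e)
    (t : N → unitInterval) : pointwiseMul m he f g t = m (f t, g t) :=
  rfl

theorem Homotopic.pointwiseMul (m : C(X × X, X)) (he : m (e, e) = e) {f f' g g' : GenLoop N X e}
    (hf : Homotopic f f') (hg : Homotopic g g') :
    Homotopic (pointwiseMul m he f g) (pointwiseMul m he f' g') :=
  HomotopicRel.comp_continuousMap (hf.map2 HomotopyRel.prod hg) m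

/-- Composing a generalized loop with a self-map homotopic to the identity relative to the base
point does not change its homotopy class. -/
theorem homotopic_of_homotopicRel_id {φ : C(X, X)}
    (h : φ.HomotopicRel (ContinuousMap.id X) {e}) {f g : GenLoop N X e}
    (hg : ∀ t, g t = φ (f t)) : Homotopic g f := by
  obtain ⟨H⟩ := h
  exact ⟨{
    toFun := fun p ↦ H (p.1, f p.2)
    continuous_toFun := H.continuous.comp
      (continuous_fst.prodMk (f.1.continuous.comp continuous_snd))
    map_zero_left := fun t ↦ (H.apply_zero _).trans (hg t).symm
    map_one_left := fun t ↦ H.apply_one _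
    prop' := fun s t ht ↦ (H.eq_fst s (f.2 t ht)).trans (hg t).symm }⟩

theorem pointwiseMul_transAt [DecidableEq N] (m : C(X × X, X)) (he : m (e, e) = e) (i : N)
    (a b c d : GenLoop N X e) :
    pointwiseMul m he (transAt i a b) (transAt i c d) =
      transAt i (pointwiseMul m he a c) (pointwiseMul m he b d) := by
  ext t
  simp only [pointwiseMul_apply, transAt, coe_copy]
  split_ifs <;> rfl

end GenLoop

namespace HomotopyGroup

variable {N X : Type*} [TopologicalSpace X] {e : X}

/-- The operation on homotopy classes of generalized loops induced by a continuous
multiplication. -/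
def pointwiseMul (m : C(X × X, X)) (he : m (e, e) = e) :
    HomotopyGroup N X e → HomotopyGroup N X e → HomotopyGroup N X e :=
  Quotient.map₂ (GenLoop.pointwiseMul m he) fun _ _ hf _ _ hg ↦ hf.pointwiseMul m he hg

theorem isUnital_pointwiseMul (m : C(X × X, X)) (he : m (e, e) = e)
    (left_unit : HomotopicRel (m.comp ((ContinuousMap.const X e).prodMk (ContinuousMap.id X)))
      (ContinuousMap.id X) {e})
    (right_unit : HomotopicRel (m.comp ((ContinuousMap.id X).prodMk (ContinuousMap.const X e)))
      (ContinuousMap.id X) {e}) :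
    EckmannHilton.IsUnital (pointwiseMul m he)
      (Quotient.mk _ GenLoop.const : HomotopyGroup N X e) where
  left_id := by
    rintro ⟨f⟩
    exact Quotient.sound (GenLoop.homotopic_of_homotopicRel_id left_unit fun _ ↦ rfl)
  right_id := by
    rintro ⟨f⟩
    exact Quotient.sound (GenLoop.homotopic_of_homotopicRel_id right_unit fun _ ↦ rfl)

theorem pointwiseMul_mul_mul [DecidableEq N] [Nonempty N] (m : C(X × X, X)) (he : m (e, e) = e)
    (a b c d : HomotopyGroup N X e) :
    pointwiseMul m he (a * b) (c * d) = pointwiseMul m he a c * pointwiseMul m he b d := by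
  induction a, b using Quotient.inductionOn₂ with | _ a b
  induction c, d using Quotient.inductionOn₂ with | _ c d
  let i := Classical.arbitrary N
  exact (congrArg₂ (pointwiseMul m he) (mul_spec (i := i)) (mul_spec (i := i))).trans
    ((congrArg (Quotient.mk _) (GenLoop.pointwiseMul_transAt m he i b a d c)).trans
      (mul_spec (i := i)).symm)

/-- For an H-space, the operation on homotopy groups induced by the multiplication is the
group law. -/
theorem pointwiseMul_eq_mul [DecidableEq N] [Nonempty N] (m : C(X × X, X)) (he : m (e, e) = e)
    (left_unit : HomotopicRel (m.comp ((ContinuousMap.const X e).prodMk (ContinuousMap.id X)))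
      (ContinuousMap.id X) {e})
    (right_unit : HomotopicRel (m.comp ((ContinuousMap.id X).prodMk (ContinuousMap.const X e)))
      (ContinuousMap.id X) {e}) (a b : HomotopyGroup N X e) :
    pointwiseMul m he a b = a * b :=
  congr_fun₂ (EckmannHilton.mul (isUnital_pointwiseMul m he left_unit right_unit)
    EckmannHilton.MulOneClass.isUnital (pointwiseMul_mul_mul m he)) a b

theorem pointwiseMul_self (m : C(X × X, X)) (he : m (e, e) = e)
    (diag : HomotopicRel (m.comp ((ContinuousMap.id X).prodMk (ContinuousMap.id X)))
      (ContinuousMap.id X) {e}) (a : HomotopyGroup N X e) :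
    pointwiseMul m he a a = a := by
  induction a using Quotient.inductionOn with | _ f
  exact Quotient.sound (GenLoop.homotopic_of_homotopicRel_id diag fun _ ↦ rfl)

end HomotopyGroup

/-- If `(X, m, e)` is an H-space (unit up to homotopy rel `{e}`) for which the composite
of the diagonal with the multiplication, `x ↦ m (x, x)`, is homotopic to the identity rel
`{e}`, then all homotopy groups `πₙ(X, e)` for `n ≥ 1` are trivial. -/
theorem stmt_2 {X : Type*} [TopologicalSpace X]
    (m : C(X × X, X)) (e : X) (he : m (e, e) = e)
    (left_unit : Nonempty (HomotopyRel
      (m.comp ((ContinuousMap.const X e).prodMk (ContinuousMap.id X)))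
      (ContinuousMap.id X) {e}))
    (right_unit : Nonempty (HomotopyRel
      (m.comp ((ContinuousMap.id X).prodMk (ContinuousMap.const X e)))
      (ContinuousMap.id X) {e}))
    (diag : Nonempty (HomotopyRel
      (m.comp ((ContinuousMap.id X).prodMk (ContinuousMap.id X)))
      (ContinuousMap.id X) {e})) :
    ∀ n : ℕ, 1 ≤ n → Subsingleton (HomotopyGroup (Fin n) X e) := by
  intro n hn
  have : NeZero n := ⟨by omega⟩
  refine subsingleton_of_forall_eq 1 fun a ↦ ?_
  rw [← mul_eq_left (a := a), ← HomotopyGroup.pointwiseMul_eq_mul m he left_unit right_unit]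
  exact HomotopyGroup.pointwiseMul_self m he diag a
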